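/- arXiv:2006.06657 — 2 statements merged into one kernel-verified Lean document; each statement's English description precedes it below -/
import Mathlib

section
/- Let p_1,…,p_n : ℝ^k → ℝ be twice continuously differentiable and L-positively homogeneous for some L > 0, let ℓ be either the exponential loss or the logistic loss, let 𝓛(W) = Σ_{i=1}^n ℓ(p_i(W)), and let W : [0,∞) → ℝ^k be a C¹ gradient flow curve with dW_t/dt = −∇𝓛(W_t) for all t ≥ 0 and initial condition 𝓛(W_0) < ℓ(0). Then for all t the vectors W_t and ∇𝓛(W_t) are nonzero, and the angle θ_t between W_t and −∇𝓛(W_t) converges to 0 as t → ∞; equivalently, ⟨W_t, −∇𝓛(W_t)⟩/(‖W_t‖·‖∇𝓛(W_t)‖) → 1. -/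
open Filter

open scoped RealInnerProductSpace

/-- A function with nonnegative derivative on `[0, ∞)` is monotone there. -/
theorem monotoneOn_Ici_of_hasDerivAt_nonneg {f f' : ℝ → ℝ} (hf : ∀ t, 0 ≤ t → HasDerivAt f (f' t) t)
    (hf' : ∀ t, 0 ≤ t → 0 ≤ f' t) : MonotoneOn f (Set.Ici 0) := by
  apply monotoneOn_of_hasDerivWithinAt_nonneg (f' := f') (convex_Ici 0)
  · exact fun t ht => (hf t ht).continuousAt.continuousWithinAt
  · exact fun t ht => (hf t (interior_subset ht)).hasDerivWithinAt
  · exact fun t ht => hf' t (interior_subset ht)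

theorem exists_tendsto_of_monotoneOn_Ici {f : ℝ → ℝ} (hf : MonotoneOn f (Set.Ici 0)) {B : ℝ}
    (hB : ∀ t, 0 ≤ t → f t ≤ B) : ∃ l, Tendsto f atTop (nhds l) := by
  have hmono : Monotone fun t => f (max t 0) := fun s t hst =>
    hf (Set.mem_Ici.2 (le_max_right _ _)) (Set.mem_Ici.2 (le_max_right _ _)) (max_le_max_right _ hst)
  have hbdd : BddAbove (Set.range fun t => f (max t 0)) := by
    refine ⟨B, ?_⟩
    rintro _ ⟨t, rfl⟩
    exact hB _ (le_max_right _ _)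
  refine ⟨_, (tendsto_atTop_ciSup hmono hbdd).congr' ?_⟩
  filter_upwards [eventually_ge_atTop 0] with t ht
  simp [max_eq_left ht]

/-- If a nonnegative `h` grows at rate at most `C * r`, while a bounded `γ` grows at rate at
least `h * r`, and `r` has infinite integral (it dominates the derivative of a function tending
to infinity), then `h` tends to zero. -/
theorem tendsto_zero_of_deriv_bounds {γ γ' h h' lam lam' r : ℝ → ℝ} {B C : ℝ} (hC : 0 ≤ C)
    (hγ : ∀ t, 0 ≤ t → HasDerivAt γ (γ' t) t) (hh : ∀ t, 0 ≤ t → HasDerivAt h (h' t) t)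
    (hlam : ∀ t, 0 ≤ t → HasDerivAt lam (lam' t) t)
    (hr : ∀ t, 0 ≤ t → 0 ≤ r t)
    (hpos : ∀ t, 0 ≤ t → 0 ≤ h t) (hB : ∀ t, 0 ≤ t → γ t ≤ B)
    (hγ' : ∀ t, 0 ≤ t → h t * r t ≤ γ' t) (hh' : ∀ t, 0 ≤ t → h' t ≤ C * r t)
    (hlam' : ∀ t, 0 ≤ t → lam' t ≤ r t) (hlim : Tendsto lam atTop atTop) :
    Tendsto h atTop (nhds 0) := by
  obtain ⟨a, ha⟩ := exists_tendsto_of_monotoneOn_Ici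
    (monotoneOn_Ici_of_hasDerivAt_nonneg hγ fun t ht => (mul_nonneg (hpos t ht) (hr t ht)).trans (hγ' t ht)) hB
  obtain ⟨b, hb⟩ : ∃ b, Tendsto (fun t => C * γ t - h t ^ 2 / 2) atTop (nhds b) := by
    refine exists_tendsto_of_monotoneOn_Ici (B := C * B)
      (monotoneOn_Ici_of_hasDerivAt_nonneg (f' := fun t => C * γ' t - h t * h' t) (fun t ht => ?_)
        fun t ht => ?_) fun t ht => ?_
    · refine (((hγ t ht).const_mul C).sub (((hh t ht).pow 2).div_const 2)).congr_deriv ?_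
      simp only [Nat.cast_ofNat]
      ring
    · have h1 := mul_le_mul_of_nonneg_left (hh' t ht) (hpos t ht)
      have h2 := mul_le_mul_of_nonneg_left (hγ' t ht) hC
      linarith
    · have := mul_le_mul_of_nonneg_left (hB t ht) hC
      nlinarith [sq_nonneg (h t)]
  have hsq : Tendsto (fun t => h t ^ 2) atTop (nhds (2 * (C * a - b))) := by
    refine (((ha.const_mul C).sub hb).const_mul 2).congr fun t => ?_
    ring
  have hlimh : Tendsto h atTop (nhds √(2 * (C * a - b))) := by
    refine hsq.sqrt.congr' ?_
    filter_upwards [eventually_ge_atTop 0] with t ht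
    exact Real.sqrt_sq (hpos t ht)
  obtain ⟨m, hm_def⟩ : ∃ m, m = √(2 * (C * a - b)) := ⟨_, rfl⟩
  rw [← hm_def] at hlimh
  rcases (hm_def ▸ Real.sqrt_nonneg _ : 0 ≤ m).eq_or_lt with hm | hm
  · rwa [← hm] at hlimh
  exfalso
  obtain ⟨T, hT⟩ := eventually_atTop.1 (hlimh.eventually (eventually_ge_nhds (half_lt_self hm)))
  obtain ⟨T0, hTT0, hT0⟩ : ∃ T0, T ≤ T0 ∧ 0 ≤ T0 := ⟨max T 0, le_max_left _ _, le_max_right _ _⟩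
  have hmono := monotoneOn_Ici_of_hasDerivAt_nonneg
    (f := fun t => γ (t + T0) - m / 2 * lam (t + T0))
    (f' := fun t => γ' (t + T0) - m / 2 * lam' (t + T0))
    (fun t ht => by
      have h0 : 0 ≤ t + T0 := add_nonneg ht hT0
      exact ((hγ _ h0).comp_add_const t T0).sub (((hlam _ h0).comp_add_const t T0).const_mul _))
    (fun t ht => by
      have h0 : 0 ≤ t + T0 := add_nonneg ht hT0
      have h1 : m / 2 ≤ h (t + T0) := hT _ (hTT0.trans (by linarith))
      have h2 := mul_le_mul_of_nonneg_right h1 (hr _ h0)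
      have h3 := mul_le_mul_of_nonneg_left (hlam' _ h0) (half_pos hm).le
      have h4 := hγ' _ h0
      linarith)
  have hlim' : Tendsto (fun t => m / 2 * lam (t + T0)) atTop atTop :=
    (hlim.comp (tendsto_atTop_add_const_right _ T0 tendsto_id)).const_mul_atTop (half_pos hm)
  obtain ⟨t, ht, ht0⟩ := ((hlim'.eventually_gt_atTop
    (B - (γ (0 + T0) - m / 2 * lam (0 + T0)))).and (eventually_ge_atTop 0)).exists
  have h1 := hmono (Set.mem_Ici.2 le_rfl) (Set.mem_Ici.2 ht0) ht0
  have h2 := hB (t + T0) (add_nonneg ht0 hT0)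
  simp only at h1
  linarith

/-- The relations a loss `ℓ` satisfies with its inverse `F` and the function `g` for which
`ℓ' = -g ∘ ℓ`, with `g'` the derivative of `g`. -/
structure LossProfile (ℓ g g' F : ℝ → ℝ) : Prop where
  loss_pos : ∀ z, 0 < ℓ z
  hasDerivAt_loss : ∀ z, HasDerivAt ℓ (-g (ℓ z)) z
  inv_loss : ∀ z, F (ℓ z) = z
  inv_lt : ∀ x y, 0 < x → x < y → F y < F x
  hasDerivAt_inv : ∀ x, 0 < x → HasDerivAt F (-(g x)⁻¹) x
  rate_pos : ∀ x, 0 < x → 0 < g x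
  deriv_rate_pos : ∀ x, 0 < x → 0 < g' x
  hasDerivAt_rate : ∀ x, 0 < x → HasDerivAt g (g' x) x
  rate_le : ∀ x y, 0 < x → x ≤ y → g x ≤ g y
  rate_add_le : ∀ x y, 0 < x → 0 < y → g (x + y) ≤ g x + g y
  ratio_add_le : ∀ x y, 0 < x → 0 < y → g x / g' x + g y / g' y ≤ g (x + y) / g' (x + y)

theorem lossProfile_exp :
    LossProfile (fun z => Real.exp (-z)) id (fun _ => 1) (fun x => -Real.log x) where
  loss_pos z := Real.exp_pos _
  hasDerivAt_loss z := by simpa using (hasDerivAt_neg z).exp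
  inv_loss z := by simp
  inv_lt x y hx hxy := neg_lt_neg (Real.log_lt_log hx hxy)
  hasDerivAt_inv x hx := (Real.hasDerivAt_log hx.ne').neg
  rate_pos x hx := hx
  deriv_rate_pos x _ := one_pos
  hasDerivAt_rate x _ := hasDerivAt_id x
  rate_le x y _ hxy := hxy
  rate_add_le x y _ _ := le_rfl
  ratio_add_le x y _ _ := by simp

theorem lossProfile_logistic :
    LossProfile (fun z => Real.log (1 + Real.exp (-z))) (fun x => 1 - Real.exp (-x))
      (fun x => Real.exp (-x)) (fun x => -Real.log (Real.exp x - 1)) where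
  loss_pos z := Real.log_pos (by linarith [Real.exp_pos (-z)])
  hasDerivAt_loss z := by
    have h : 0 < 1 + Real.exp (-z) := by positivity
    refine (((hasDerivAt_neg z).exp.const_add 1).log h.ne').congr_deriv ?_
    rw [Real.exp_neg (Real.log _), Real.exp_log h]
    field_simp
    ring
  inv_loss z := by
    have h : 0 < 1 + Real.exp (-z) := by positivity
    simp [Real.exp_log h]
  inv_lt x y hx hxy := by
    refine neg_lt_neg (Real.log_lt_log ?_ ?_)
    · linarith [Real.add_one_lt_exp hx.ne']
    · linarith [Real.exp_lt_exp.2 hxy]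
  hasDerivAt_inv x hx := by
    have h : 0 < Real.exp x - 1 := by linarith [Real.add_one_lt_exp hx.ne']
    refine (((Real.hasDerivAt_exp x).sub_const 1).log h.ne').neg.congr_deriv ?_
    rw [Real.exp_neg]
    have := Real.exp_pos x
    field_simp
  rate_pos x hx := by
    have : Real.exp (-x) < 1 := Real.exp_lt_one_iff.2 (by linarith)
    linarith
  deriv_rate_pos x _ := Real.exp_pos _
  hasDerivAt_rate x _ := by
    simpa using (hasDerivAt_neg x).exp.const_sub 1
  rate_le x y _ hxy := by
    have : Real.exp (-y) ≤ Real.exp (-x) := Real.exp_le_exp.2 (by linarith)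
    linarith
  rate_add_le x y hx hy := by
    have h1 : Real.exp (-x) < 1 := Real.exp_lt_one_iff.2 (by linarith)
    have h2 : Real.exp (-y) < 1 := Real.exp_lt_one_iff.2 (by linarith)
    rw [neg_add, Real.exp_add]
    nlinarith
  ratio_add_le x y hx hy := by
    have h1 : 1 < Real.exp x := Real.one_lt_exp_iff.2 hx
    have h2 : 1 < Real.exp y := Real.one_lt_exp_iff.2 hy
    have key : ∀ z : ℝ, (1 - Real.exp (-z)) / Real.exp (-z) = Real.exp z - 1 := fun z => by
      rw [Real.exp_neg]
      have := Real.exp_pos z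
      field_simp
    rw [key, key, key, Real.exp_add]
    nlinarith

theorem LossProfile.rate_sum_le {ℓ g g' F : ℝ → ℝ} (hℓ : LossProfile ℓ g g' F) {ι : Type*}
    {s : Finset ι} (hs : s.Nonempty) (x : ι → ℝ) (hx : ∀ i, 0 < x i) :
    g (∑ i ∈ s, x i) ≤ ∑ i ∈ s, g (x i) := by
  induction hs using Finset.Nonempty.cons_induction with
  | singleton a => simp
  | cons a s ha hs ih =>
    rw [Finset.sum_cons, Finset.sum_cons]
    have := hℓ.rate_add_le _ _ (hx a) (Finset.sum_pos (fun i _ => hx i) hs)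
    linarith

theorem LossProfile.sum_ratio_le {ℓ g g' F : ℝ → ℝ} (hℓ : LossProfile ℓ g g' F) {ι : Type*}
    {s : Finset ι} (hs : s.Nonempty) (x : ι → ℝ) (hx : ∀ i, 0 < x i) :
    ∑ i ∈ s, g (x i) / g' (x i) ≤ g (∑ i ∈ s, x i) / g' (∑ i ∈ s, x i) := by
  induction hs using Finset.Nonempty.cons_induction with
  | singleton a => simp
  | cons a s ha hs ih =>
    rw [Finset.sum_cons, Finset.sum_cons]
    have := hℓ.ratio_add_le _ _ (hx a) (Finset.sum_pos (fun i _ => hx i) hs)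
    linarith

/-- The Hessian of the smoothed margin `F (∑ i, x i)` in the individual margins is negative
semidefinite. -/
theorem LossProfile.concavity {ℓ g g' F : ℝ → ℝ} (hℓ : LossProfile ℓ g g' F) {ι : Type*}
    [Fintype ι] [Nonempty ι] (x : ι → ℝ) (hx : ∀ i, 0 < x i) (v : ι → ℝ) :
    g' (∑ i, x i) / g (∑ i, x i) * (∑ i, g (x i) * v i) ^ 2 ≤
      ∑ i, g' (x i) * g (x i) * v i ^ 2 := by
  have hratio : ∀ i, 0 < g (x i) / g' (x i) := fun i =>
    div_pos (hℓ.rate_pos _ (hx i)) (hℓ.deriv_rate_pos _ (hx i))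
  have hS : 0 < ∑ i, x i := Finset.sum_pos (fun i _ => hx i) Finset.univ_nonempty
  have hcs := Finset.sq_sum_div_le_sum_sq_div Finset.univ (fun i => g (x i) * v i)
    (g := fun i => g (x i) / g' (x i)) fun i _ => hratio i
  have hle := hℓ.sum_ratio_le Finset.univ_nonempty x hx
  have hpos : 0 < ∑ i, g (x i) / g' (x i) :=
    Finset.sum_pos (fun i _ => hratio i) Finset.univ_nonempty
  calc g' (∑ i, x i) / g (∑ i, x i) * (∑ i, g (x i) * v i) ^ 2
      = (∑ i, g (x i) * v i) ^ 2 / (g (∑ i, x i) / g' (∑ i, x i)) := by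
        rw [div_div_eq_mul_div]; ring
    _ ≤ (∑ i, g (x i) * v i) ^ 2 / ∑ i, g (x i) / g' (x i) :=
        div_le_div_of_nonneg_left (sq_nonneg _) hpos hle
    _ ≤ _ := hcs
    _ = ∑ i, g' (x i) * g (x i) * v i ^ 2 := by
        refine Finset.sum_congr rfl fun i _ => ?_
        have h1 := (hℓ.rate_pos _ (hx i)).ne'
        have h2 := (hℓ.deriv_rate_pos _ (hx i)).ne'
        field_simp

theorem LossProfile.loss_le_total {ℓ g g' F : ℝ → ℝ} (hℓ : LossProfile ℓ g g' F) {ι : Type*}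
    [Fintype ι] (z : ι → ℝ) (i : ι) : ℓ (z i) ≤ ∑ j, ℓ (z j) :=
  Finset.single_le_sum (f := fun j => ℓ (z j)) (fun _ _ => (hℓ.loss_pos _).le)
    (Finset.mem_univ i)

theorem LossProfile.rate_le_total {ℓ g g' F : ℝ → ℝ} (hℓ : LossProfile ℓ g g' F) {ι : Type*}
    [Fintype ι] (z : ι → ℝ) (i : ι) : g (ℓ (z i)) ≤ g (∑ j, ℓ (z j)) :=
  hℓ.rate_le _ _ (hℓ.loss_pos _) (hℓ.loss_le_total z i)

theorem LossProfile.inv_total_le {ℓ g g' F : ℝ → ℝ} (hℓ : LossProfile ℓ g g' F) {ι : Type*}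
    [Fintype ι] (z : ι → ℝ) (i : ι) : F (∑ j, ℓ (z j)) ≤ z i := by
  rcases (hℓ.loss_le_total z i).eq_or_lt with h | h
  · rw [← h, hℓ.inv_loss]
  · simpa only [hℓ.inv_loss] using (hℓ.inv_lt _ _ (hℓ.loss_pos _) h).le

section Homogeneous

variable {E G : Type*} [NormedAddCommGroup E] [NormedAddCommGroup G] [NormedSpace ℝ G]

theorem exists_norm_le_of_homogeneous [NormedSpace ℝ E] [ProperSpace E] {Φ : E → G} {a : ℝ}
    (hΦ : Continuous Φ) (hhom : ∀ c : ℝ, 0 < c → ∀ x, Φ (c • x) = c ^ a • Φ x) :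
    ∃ C, 0 ≤ C ∧ ∀ x, x ≠ 0 → ‖Φ x‖ ≤ C * ‖x‖ ^ a := by
  obtain ⟨C, hC⟩ := (isCompact_sphere (0 : E) 1).exists_bound_of_continuousOn hΦ.continuousOn
  refine ⟨max C 0, le_max_right _ _, fun x hx => ?_⟩
  have hx' : 0 < ‖x‖ := norm_pos_iff.2 hx
  have hu : ‖x‖⁻¹ • x ∈ Metric.sphere (0 : E) 1 := by
    simp [norm_smul, hx'.ne']
  have hx_eq : Φ x = ‖x‖ ^ a • Φ (‖x‖⁻¹ • x) := by
    rw [← hhom _ hx', smul_smul, mul_inv_cancel₀ hx'.ne', one_smul]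
  rw [hx_eq, norm_smul, Real.norm_of_nonneg (by positivity), mul_comm]
  exact mul_le_mul_of_nonneg_right ((hC _ hu).trans (le_max_left _ _)) (by positivity)

theorem fderiv_homogeneous [NormedSpace ℝ E] {Φ : E → G} {a : ℝ}
    (hhom : ∀ c : ℝ, 0 < c → ∀ x, Φ (c • x) = c ^ a • Φ x) (c : ℝ) (hc : 0 < c) (x : E) :
    fderiv ℝ Φ (c • x) = c ^ (a - 1) • fderiv ℝ Φ x := by
  have h1 : fderiv ℝ (fun y => Φ (c • y)) x = c • fderiv ℝ Φ (c • x) := fderiv_comp_smul c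
  have h2 : fderiv ℝ (fun y => Φ (c • y)) x = c ^ a • fderiv ℝ Φ x := by
    rw [show (fun y => Φ (c • y)) = c ^ a • Φ from funext (hhom c hc), fderiv_const_smul_field,
      Pi.smul_apply]
  rw [Real.rpow_sub_one hc.ne', div_eq_inv_mul, mul_smul, ← h2, h1, inv_smul_smul₀ hc.ne']

variable [InnerProductSpace ℝ E] [ProperSpace E]

theorem gradient_homogeneous {p : E → ℝ} {a : ℝ}
    (hhom : ∀ c : ℝ, 0 < c → ∀ x, p (c • x) = c ^ a • p x) (c : ℝ) (hc : 0 < c) (x : E) :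
    gradient p (c • x) = c ^ (a - 1) • gradient p x := by
  simp only [gradient]
  rw [fderiv_homogeneous hhom c hc]
  simp

theorem inner_gradient_self {p : E → ℝ} {a : ℝ} (hp : Differentiable ℝ p)
    (hhom : ∀ c : ℝ, 0 < c → ∀ x, p (c • x) = c ^ a • p x) (x : E) :
    ⟪x, gradient p x⟫ = a * p x := by
  have h1 : HasDerivAt (fun c : ℝ => p (c • x)) (fderiv ℝ p x x) 1 := by
    have h := (hp ((1 : ℝ) • x)).hasFDerivAt.comp_hasDerivAt (1 : ℝ)
      ((hasDerivAt_id (1 : ℝ)).smul_const x)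
    simp only [id, one_smul] at h
    exact h
  have h2 : HasDerivAt (fun c : ℝ => p (c • x)) (a * p x) 1 := by
    have h := (Real.hasDerivAt_rpow_const (x := 1) (p := a) (Or.inl one_ne_zero)).mul_const (p x)
    rw [Real.one_rpow, mul_one] at h
    refine h.congr_of_eventuallyEq ?_
    filter_upwards [eventually_gt_nhds one_pos] with c hc
    exact hhom c hc x
  rw [real_inner_comm, ← h1.unique h2, (hp x).hasGradientAt.hasFDerivAt.fderiv,
    InnerProductSpace.toDual_apply_apply]

theorem contDiff_gradient {p : E → ℝ} (hp : ContDiff ℝ 2 p) : ContDiff ℝ 1 (gradient p) :=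
  (InnerProductSpace.toDual ℝ E).symm.contDiff.comp
    (hp.fderiv_right (by norm_num))

end Homogeneous

section Descent

variable {E : Type*} [NormedAddCommGroup E] [InnerProductSpace ℝ E] [ProperSpace E]
  {ι : Type*} [Fintype ι] {ℓ g g' F : ℝ → ℝ} {p : ι → E → ℝ}

/-- The negative gradient of the total loss `∑ i, ℓ (p i x)` when `ℓ' = -g ∘ ℓ`. -/
noncomputable def descent (ℓ g : ℝ → ℝ) (p : ι → E → ℝ) (x : E) : E :=
  ∑ i, g (ℓ (p i x)) • gradient (p i) x

theorem hasGradientAt_totalLoss (hℓ : LossProfile ℓ g g' F) (hp : ∀ i, Differentiable ℝ (p i))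
    (x : E) : HasGradientAt (fun y => ∑ i, ℓ (p i y)) (-descent ℓ g p x) x := by
  rw [hasGradientAt_iff_hasFDerivAt]
  refine (HasFDerivAt.fun_sum fun i _ => (hℓ.hasDerivAt_loss (p i x)).comp_hasFDerivAt x
    (hp i x).hasGradientAt.hasFDerivAt).congr_fderiv ?_
  simp [descent, map_sum]

theorem hasDerivAt_descent (hℓ : LossProfile ℓ g g' F) (hp : ∀ i, ContDiff ℝ 2 (p i))
    {W : ℝ → E} {v : E} {t : ℝ} (hW : HasDerivAt W v t) :
    HasDerivAt (fun s => descent ℓ g p (W s))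
      (∑ i, (g (ℓ (p i (W t))) • fderiv ℝ (gradient (p i)) (W t) v -
        (g' (ℓ (p i (W t))) * g (ℓ (p i (W t))) * ⟪gradient (p i) (W t), v⟫) •
          gradient (p i) (W t))) t := by
  refine HasDerivAt.fun_sum fun i _ => ?_
  have h1 : HasDerivAt (fun s => p i (W s)) ⟪gradient (p i) (W t), v⟫ t :=
    ((hp i).differentiable two_ne_zero (W t)).hasGradientAt.hasFDerivAt.comp_hasDerivAt t hW
  have h2 := (hℓ.hasDerivAt_rate _ (hℓ.loss_pos (p i (W t)))).comp t
    ((hℓ.hasDerivAt_loss (p i (W t))).comp t h1)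
  have h3 := ((contDiff_gradient (hp i)).differentiable one_ne_zero (W t)).hasFDerivAt.comp_hasDerivAt
      t hW
  refine (h2.smul h3).congr_deriv ?_
  simp only [Function.comp_apply, sub_eq_add_neg, ← neg_smul]
  congr 2
  ring

theorem inner_descent_self (hp : ∀ i, Differentiable ℝ (p i)) {L : ℝ}
    (hhom : ∀ i (c : ℝ), 0 < c → ∀ x, p i (c • x) = c ^ L * p i x) (x : E) :
    ⟪x, descent ℓ g p x⟫ = L * ∑ i, g (ℓ (p i x)) * p i x := by
  simp only [descent, inner_sum, inner_smul_right, inner_gradient_self (hp _) (hhom _),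
    Finset.mul_sum]
  refine Finset.sum_congr rfl fun i _ => ?_
  ring

theorem margin_le_inner_descent [Nonempty ι] (hℓ : LossProfile ℓ g g' F)
    (hp : ∀ i, Differentiable ℝ (p i)) {L : ℝ} (hL : 0 < L)
    (hhom : ∀ i (c : ℝ), 0 < c → ∀ x, p i (c • x) = c ^ L * p i x) (x : E)
    (hx : 0 < F (∑ i, ℓ (p i x))) :
    L * (g (∑ i, ℓ (p i x)) * F (∑ i, ℓ (p i x))) ≤ ⟪x, descent ℓ g p x⟫ := by
  rw [inner_descent_self hp hhom]
  refine mul_le_mul_of_nonneg_left ?_ hL.le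
  calc _ ≤ (∑ i, g (ℓ (p i x))) * F (∑ i, ℓ (p i x)) :=
        mul_le_mul_of_nonneg_right
          (hℓ.rate_sum_le Finset.univ_nonempty _ fun i => hℓ.loss_pos _) hx.le
    _ = ∑ i, g (ℓ (p i x)) * F (∑ i, ℓ (p i x)) := Finset.sum_mul _ _ _
    _ ≤ _ := Finset.sum_le_sum fun i _ =>
        mul_le_mul_of_nonneg_left (hℓ.inv_total_le (fun j => p j x) i) (hℓ.rate_pos _ (hℓ.loss_pos _)).le

theorem norm_descent_le (hℓ : LossProfile ℓ g g' F) (x : E) :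
    ‖descent ℓ g p x‖ ≤ g (∑ i, ℓ (p i x)) * ∑ i, ‖gradient (p i) x‖ := by
  rw [Finset.mul_sum]
  refine (norm_sum_le _ _).trans (Finset.sum_le_sum fun i _ => ?_)
  rw [norm_smul, Real.norm_of_nonneg (hℓ.rate_pos _ (hℓ.loss_pos _)).le]
  exact mul_le_mul_of_nonneg_right (hℓ.rate_le_total (fun j => p j x) i) (norm_nonneg _)

theorem curvature_le [Nonempty ι] (hℓ : LossProfile ℓ g g' F) (x v : E)
    (hv : v = descent ℓ g p x) :
    ⟪v, ∑ i, (g (ℓ (p i x)) • fderiv ℝ (gradient (p i)) x v -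
        (g' (ℓ (p i x)) * g (ℓ (p i x)) * ⟪gradient (p i) x, v⟫) • gradient (p i) x)⟫ +
      g' (∑ i, ℓ (p i x)) / g (∑ i, ℓ (p i x)) * ‖v‖ ^ 4 ≤
    g (∑ i, ℓ (p i x)) * (∑ i, ‖fderiv ℝ (gradient (p i)) x‖) * ‖v‖ ^ 2 := by
  have hc := hℓ.concavity (fun i => ℓ (p i x)) (fun i => hℓ.loss_pos _)
    fun i => ⟪gradient (p i) x, v⟫
  have hsum : ∑ i, g (ℓ (p i x)) * ⟪gradient (p i) x, v⟫ = ‖v‖ ^ 2 := by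
    rw [← real_inner_self_eq_norm_sq]
    nth_rw 2 [hv]
    simp only [descent, sum_inner, inner_smul_left, RCLike.conj_to_real]
  have hd : ∑ i, g (ℓ (p i x)) * ⟪v, fderiv ℝ (gradient (p i)) x v⟫ ≤
      g (∑ i, ℓ (p i x)) * (∑ i, ‖fderiv ℝ (gradient (p i)) x‖) * ‖v‖ ^ 2 := by
    rw [Finset.mul_sum, Finset.sum_mul]
    refine Finset.sum_le_sum fun i _ => ?_
    have hg := (hℓ.rate_pos _ (hℓ.loss_pos (p i x))).le
    calc _ ≤ g (ℓ (p i x)) * (‖v‖ * (‖fderiv ℝ (gradient (p i)) x‖ * ‖v‖)) := by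
          gcongr
          exact (real_inner_le_norm _ _).trans
            (mul_le_mul_of_nonneg_left (ContinuousLinearMap.le_opNorm _ _) (norm_nonneg _))
      _ ≤ g (∑ i, ℓ (p i x)) * (‖v‖ * (‖fderiv ℝ (gradient (p i)) x‖ * ‖v‖)) :=
          mul_le_mul_of_nonneg_right (hℓ.rate_le_total (fun j => p j x) i) (by positivity)
      _ = _ := by ring
  have hexp : ⟪v, ∑ i, (g (ℓ (p i x)) • fderiv ℝ (gradient (p i)) x v -
        (g' (ℓ (p i x)) * g (ℓ (p i x)) * ⟪gradient (p i) x, v⟫) • gradient (p i) x)⟫ =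
      ∑ i, g (ℓ (p i x)) * ⟪v, fderiv ℝ (gradient (p i)) x v⟫ -
        ∑ i, g' (ℓ (p i x)) * g (ℓ (p i x)) * ⟪gradient (p i) x, v⟫ ^ 2 := by
    rw [inner_sum, ← Finset.sum_sub_distrib]
    refine Finset.sum_congr rfl fun i _ => ?_
    rw [inner_sub_right, inner_smul_right, inner_smul_right, real_inner_comm v]
    ring
  rw [hsum, ← pow_mul] at hc
  rw [hexp]
  linarith

end Descent

/-- Scalar core of the alignment theorem. Here `S` is the total loss along the flow, `N` the norm
of its gradient, `ρ` the norm of the parameters, and `A` stands for `ρ ^ L`. -/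
theorem LossProfile.tendsto_alignment {ℓ g g' F : ℝ → ℝ} (hℓ : LossProfile ℓ g g' F)
    {S N N' ρ ρ' A : ℝ → ℝ} {L K₁ K₂ K₃ : ℝ} (hL : 0 < L) (hK₁ : 0 ≤ K₁) (hK₂ : 0 ≤ K₂)
    (hS : ∀ t, 0 ≤ t → HasDerivAt S (-N t ^ 2) t) (hN : ∀ t, 0 ≤ t → HasDerivAt N (N' t) t)
    (hρ : ∀ t, 0 ≤ t → HasDerivAt ρ (ρ' t) t)
    (hA : ∀ t, 0 ≤ t → HasDerivAt A (L * A t * ρ' t / ρ t) t)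
    (hSpos : ∀ t, 0 ≤ t → 0 < S t) (hNpos : ∀ t, 0 ≤ t → 0 < N t)
    (hρpos : ∀ t, 0 ≤ t → 0 < ρ t) (hApos : ∀ t, 0 ≤ t → 0 < A t)
    (hFpos : ∀ t, 0 ≤ t → 0 < F (S t)) (hρ' : ∀ t, 0 ≤ t → |ρ' t| ≤ N t)
    (hcurv : ∀ t, 0 ≤ t → N' t * N t + g' (S t) / g (S t) * N t ^ 4 ≤
      K₁ * g (S t) * (A t / ρ t ^ 2) * N t ^ 2)
    (hNle : ∀ t, 0 ≤ t → N t * ρ t ≤ K₂ * (g (S t) * A t))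
    (heuler : ∀ t, 0 ≤ t → L * (g (S t) * F (S t)) ≤ ρ t * N t)
    (hFle : ∀ t, 0 ≤ t → F (S t) ≤ K₃ * A t) (hlim : Tendsto ρ atTop atTop) :
    Tendsto (fun t => L * (g (S t) * F (S t)) / (ρ t * N t)) atTop (nhds 1) := by
  have hgpos : ∀ t, 0 ≤ t → 0 < g (S t) := fun t ht => hℓ.rate_pos _ (hSpos t ht)
  have hγ : ∀ t, 0 ≤ t → HasDerivAt (fun t => F (S t) / A t)
      ((N t ^ 2 / g (S t) - L * F (S t) * ρ' t / ρ t) / A t) t := fun t ht => by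
    have hg := hgpos t ht
    have hρ0 := hρpos t ht
    have hA0 := hApos t ht
    refine (((hℓ.hasDerivAt_inv _ (hSpos t ht)).comp t (hS t ht)).div (hA t ht)
      hA0.ne').congr_deriv ?_
    simp only [Function.comp_apply]
    field_simp
  have hG : ∀ t, 0 ≤ t → HasDerivAt (fun t => N t * ρ t / (g (S t) * A t))
      ((ρ t * (N' t + g' (S t) / g (S t) * N t ^ 3) + (1 - L) * (N t * ρ' t)) /
        (g (S t) * A t)) t := fun t ht => by
    have hg := hgpos t ht
    have hρ0 := hρpos t ht
    have hA0 := hApos t ht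
    refine (((hN t ht).mul (hρ t ht)).div
      (((hℓ.hasDerivAt_rate _ (hSpos t ht)).comp t (hS t ht)).mul (hA t ht))
      (mul_pos hg hA0).ne').congr_deriv ?_
    simp only [Function.comp_apply, Pi.mul_apply]
    field_simp
    ring
  have hh_nonneg : ∀ t, 0 ≤ t →
      0 ≤ N t * ρ t / (g (S t) * A t) - L * (F (S t) / A t) := fun t ht => by
    have hg := hgpos t ht
    have hA0 := hApos t ht
    have h : N t * ρ t / (g (S t) * A t) - L * (F (S t) / A t) =
        (ρ t * N t - L * (g (S t) * F (S t))) / (g (S t) * A t) := by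
      field_simp
    rw [h]
    exact div_nonneg (sub_nonneg.2 (heuler t ht)) (mul_pos hg hA0).le
  have hγ_ge : ∀ t, 0 ≤ t →
      (N t * ρ t / (g (S t) * A t) - L * (F (S t) / A t)) * (N t / ρ t) ≤
        (N t ^ 2 / g (S t) - L * F (S t) * ρ' t / ρ t) / A t := fun t ht => by
    have hg := hgpos t ht
    have hρ0 := hρpos t ht
    have hA0 := hApos t ht
    have h : (N t ^ 2 / g (S t) - L * F (S t) * ρ' t / ρ t) / A t -
        (N t * ρ t / (g (S t) * A t) - L * (F (S t) / A t)) * (N t / ρ t) =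
        L * F (S t) * (N t - ρ' t) / (ρ t * A t) := by
      field_simp
      ring
    have h' : 0 ≤ L * F (S t) * (N t - ρ' t) / (ρ t * A t) :=
      div_nonneg (mul_nonneg (mul_pos hL (hFpos t ht)).le
        (sub_nonneg.2 ((le_abs_self _).trans (hρ' t ht)))) (mul_pos hρ0 hA0).le
    linarith
  have hr : ∀ t, 0 ≤ t → 0 ≤ N t / ρ t := fun t ht => (div_pos (hNpos t ht) (hρpos t ht)).le
  have hγ'_nonneg : ∀ t, 0 ≤ t → 0 ≤ (N t ^ 2 / g (S t) - L * F (S t) * ρ' t / ρ t) / A t :=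
    fun t ht => (mul_nonneg (hh_nonneg t ht) (hr t ht)).trans (hγ_ge t ht)
  have hG_le : ∀ t, 0 ≤ t →
      (ρ t * (N' t + g' (S t) / g (S t) * N t ^ 3) + (1 - L) * (N t * ρ' t)) /
        (g (S t) * A t) ≤ (K₁ + |1 - L| * K₂) * (N t / ρ t) := fun t ht => by
    have hg := hgpos t ht
    have hρ0 := hρpos t ht
    have hA0 := hApos t ht
    have hN0 := hNpos t ht
    have h1 : N' t + g' (S t) / g (S t) * N t ^ 3 ≤ K₁ * g (S t) * (A t / ρ t ^ 2) * N t := by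
      refine le_of_mul_le_mul_right ?_ hN0
      linarith [hcurv t ht]
    have h2 : (1 - L) * (N t * ρ' t) ≤ |1 - L| * (N t * N t) := by
      refine (le_abs_self _).trans ?_
      rw [abs_mul, abs_mul, abs_of_pos hN0]
      gcongr
      exact hρ' t ht
    have h3 : N t ≤ K₂ * (g (S t) * A t) / ρ t := (le_div_iff₀ hρ0).2 (hNle t ht)
    rw [div_le_iff₀ (mul_pos hg hA0)]
    calc _ ≤ ρ t * (K₁ * g (S t) * (A t / ρ t ^ 2) * N t) +
          |1 - L| * (N t * (K₂ * (g (S t) * A t) / ρ t)) := by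
          refine add_le_add (mul_le_mul_of_nonneg_left h1 hρ0.le) (h2.trans ?_)
          gcongr
      _ = _ := by
          field_simp
  have hh_lim := tendsto_zero_of_deriv_bounds (B := K₃) (C := K₁ + |1 - L| * K₂)
    (lam := fun t => Real.log (ρ t)) (by positivity) hγ
    (fun t ht => (hG t ht).sub ((hγ t ht).const_mul L))
    (fun t ht => (hρ t ht).log (hρpos t ht).ne') hr hh_nonneg
    (fun t ht => (div_le_iff₀ (hApos t ht)).2 (hFle t ht)) hγ_ge
    (fun t ht => by linarith [hG_le t ht, mul_nonneg hL.le (hγ'_nonneg t ht)])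
    (fun t ht => div_le_div_of_nonneg_right ((le_abs_self _).trans (hρ' t ht)) (hρpos t ht).le)
    (Real.tendsto_log_atTop.comp hlim)
  have hγ_mono := monotoneOn_Ici_of_hasDerivAt_nonneg hγ hγ'_nonneg
  have hγ0 : 0 < L * (F (S 0) / A 0) := mul_pos hL (div_pos (hFpos 0 le_rfl) (hApos 0 le_rfl))
  have hlow := (hh_lim.div_const (L * (F (S 0) / A 0))).const_sub 1
  rw [zero_div, sub_zero] at hlow
  refine tendsto_of_tendsto_of_tendsto_of_le_of_le' hlow tendsto_const_nhds ?_ ?_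
  · filter_upwards [eventually_ge_atTop 0] with t ht
    have hg := hgpos t ht
    have hρ0 := hρpos t ht
    have hA0 := hApos t ht
    have hN0 := hNpos t ht
    have hle : L * (F (S 0) / A 0) ≤ N t * ρ t / (g (S t) * A t) :=
      (mul_le_mul_of_nonneg_left (hγ_mono (Set.mem_Ici.2 le_rfl) (Set.mem_Ici.2 ht) ht)
        hL.le).trans (sub_nonneg.1 (hh_nonneg t ht))
    have h := div_le_div_of_nonneg_left (hh_nonneg t ht) hγ0 hle
    have heq : L * (g (S t) * F (S t)) / (ρ t * N t) =
        1 - (N t * ρ t / (g (S t) * A t) - L * (F (S t) / A t)) /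
          (N t * ρ t / (g (S t) * A t)) := by
      field_simp
      ring
    rw [heq]
    exact sub_le_sub_left h 1
  · filter_upwards [eventually_ge_atTop 0] with t ht
    exact div_le_one_of_le₀ (heuler t ht) (mul_pos (hρpos t ht) (hNpos t ht)).le

theorem LossProfile.tendsto_radius_atTop {ℓ g g' F : ℝ → ℝ} (hℓ : LossProfile ℓ g g' F)
    {S ρ v : ℝ → ℝ} {L K m : ℝ} (hL : 0 < L) (hK : 0 ≤ K) (hm : 0 < m)
    (hSpos : ∀ t, 0 ≤ t → 0 < S t) (hρpos : ∀ t, 0 ≤ t → 0 < ρ t)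
    (hρ : ∀ t, 0 ≤ t → HasDerivAt ρ (v t / ρ t) t)
    (hv : ∀ t, 0 ≤ t → L * (g (S t) * F (S t)) ≤ v t) (hF : ∀ t, 0 ≤ t → m ≤ F (S t))
    (hFle : ∀ t, 0 ≤ t → F (S t) ≤ K * ρ t ^ L) : Tendsto ρ atTop atTop := by
  have hv_pos : ∀ t, 0 ≤ t → 0 < v t := fun t ht => lt_of_lt_of_le
    (mul_pos hL (mul_pos (hℓ.rate_pos _ (hSpos t ht)) (hm.trans_le (hF t ht)))) (hv t ht)
  have hmono := monotoneOn_Ici_of_hasDerivAt_nonneg hρ fun t ht => (div_pos (hv_pos t ht) (hρpos t ht)).le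
  rw [tendsto_atTop_atTop]
  by_contra! hb
  obtain ⟨b, hb⟩ := hb
  have hlt : ∀ t, 0 ≤ t → ρ t < b := fun t ht => by
    obtain ⟨s, hts, hs⟩ := hb t
    exact (hmono (Set.mem_Ici.2 ht) (Set.mem_Ici.2 (ht.trans hts)) hts).trans_lt hs
  have hS_ge : ∀ t, 0 ≤ t → ℓ (K * b ^ L) ≤ S t := fun t ht => by
    by_contra! hlt'
    have h1 := hℓ.inv_lt _ _ (hSpos t ht) hlt'
    rw [hℓ.inv_loss] at h1
    have h2 : K * ρ t ^ L ≤ K * b ^ L := by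
      have := (hρpos t ht).le
      have := (hlt t ht).le
      gcongr
    linarith [hFle t ht]
  have hc : 0 < L * (g (ℓ (K * b ^ L)) * m) :=
    mul_pos hL (mul_pos (hℓ.rate_pos _ (hℓ.loss_pos _)) hm)
  have hsq := monotoneOn_Ici_of_hasDerivAt_nonneg
    (f := fun t => ρ t ^ 2 - 2 * (L * (g (ℓ (K * b ^ L)) * m)) * t)
    (f' := fun t => 2 * v t - 2 * (L * (g (ℓ (K * b ^ L)) * m)))
    (fun t ht => by
      have := (hρpos t ht).ne'
      refine (((hρ t ht).pow 2).sub ((hasDerivAt_id t).const_mul _)).congr_deriv ?_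
      field_simp
      norm_num
      ring)
    (fun t ht => by
      have h1 : g (ℓ (K * b ^ L)) * m ≤ g (S t) * F (S t) :=
        mul_le_mul (hℓ.rate_le _ _ (hℓ.loss_pos _) (hS_ge t ht)) (hF t ht) hm.le
          (hℓ.rate_pos _ (hSpos t ht)).le
      have h2 := mul_le_mul_of_nonneg_left h1 hL.le
      linarith [hv t ht])
  have hT : 0 ≤ b ^ 2 / (2 * (L * (g (ℓ (K * b ^ L)) * m))) := by positivity
  have h1 := hsq (Set.mem_Ici.2 le_rfl) (Set.mem_Ici.2 hT) hT
  simp only [mul_zero, sub_zero] at h1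
  rw [mul_div_cancel₀ _ (by positivity)] at h1
  have h2 : ρ (b ^ 2 / (2 * (L * (g (ℓ (K * b ^ L)) * m)))) ^ 2 < b ^ 2 :=
    pow_lt_pow_left₀ (hlt _ hT) (hρpos _ hT).le two_ne_zero
  have h3 := sq_nonneg (ρ 0)
  linarith

theorem HasDerivAt.norm_of_ne_zero {E : Type*} [NormedAddCommGroup E] [InnerProductSpace ℝ E]
    {f : ℝ → E} {f' : E} {t : ℝ} (hf : HasDerivAt f f' t) (h0 : f t ≠ 0) :
    HasDerivAt (fun s => ‖f s‖) (⟪f t, f'⟫ / ‖f t‖) t := by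
  have hpos : 0 < ‖f t‖ := norm_pos_iff.2 h0
  have h := hf.norm_sq.sqrt (pow_pos hpos 2).ne'
  simp only [Real.sqrt_sq (norm_nonneg _)] at h
  refine h.congr_deriv ?_
  field_simp

theorem LossProfile.flow_alignment {ℓ g g' F : ℝ → ℝ} (hℓ : LossProfile ℓ g g' F)
    {E : Type*} [NormedAddCommGroup E] [InnerProductSpace ℝ E] [ProperSpace E]
    {ι : Type*} [Fintype ι] [Nonempty ι] {L : ℝ} (hL : 0 < L) {p : ι → E → ℝ}
    (hp : ∀ i, ContDiff ℝ 2 (p i))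
    (hhom : ∀ i (c : ℝ), 0 < c → ∀ x, p i (c • x) = c ^ L * p i x) {W : ℝ → E}
    (hW : ∀ t : ℝ, 0 ≤ t → HasDerivAt W (descent ℓ g p (W t)) t)
    (hinit : ∑ i, ℓ (p i (W 0)) < ℓ 0) :
    (∀ t : ℝ, 0 ≤ t → W t ≠ 0 ∧ descent ℓ g p (W t) ≠ 0) ∧
    Tendsto (fun t => ⟪W t, descent ℓ g p (W t)⟫ / (‖W t‖ * ‖descent ℓ g p (W t)‖))
      atTop (nhds 1) := by
  have hpd : ∀ i, Differentiable ℝ (p i) := fun i => (hp i).differentiable two_ne_zero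
  have hgrad_hom : ∀ i (c : ℝ), 0 < c → ∀ x,
      gradient (p i) (c • x) = c ^ (L - 1) • gradient (p i) x := fun i =>
    gradient_homogeneous (hhom i)
  choose C₀ hC₀ hC₀_le using fun i => exists_norm_le_of_homogeneous (hp i).continuous (hhom i)
  choose C₁ hC₁ hC₁_le using fun i =>
    exists_norm_le_of_homogeneous (contDiff_gradient (hp i)).continuous (hgrad_hom i)
  choose C₂ hC₂ hC₂_le using fun i => exists_norm_le_of_homogeneous
    ((contDiff_gradient (hp i)).continuous_fderiv one_ne_zero)
    (fderiv_homogeneous (hgrad_hom i))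
  have hSpos : ∀ t, 0 < ∑ i, ℓ (p i (W t)) := fun t =>
    Finset.sum_pos (fun i _ => hℓ.loss_pos _) Finset.univ_nonempty
  have hS : ∀ t, 0 ≤ t → HasDerivAt (fun t => ∑ i, ℓ (p i (W t)))
      (-‖descent ℓ g p (W t)‖ ^ 2) t := fun t ht => by
    refine ((hasGradientAt_totalLoss hℓ hpd (W t)).hasFDerivAt.comp_hasDerivAt t
      (hW t ht)).congr_deriv ?_
    rw [InnerProductSpace.toDual_apply_apply, inner_neg_left, real_inner_self_eq_norm_sq]
  have hF0 : 0 < F (∑ i, ℓ (p i (W 0))) := by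
    simpa only [hℓ.inv_loss] using hℓ.inv_lt _ _ (hSpos 0) hinit
  have hF : ∀ t, 0 ≤ t → F (∑ i, ℓ (p i (W 0))) ≤ F (∑ i, ℓ (p i (W t))) := fun t ht =>
    monotoneOn_Ici_of_hasDerivAt_nonneg (f := fun t => F (∑ i, ℓ (p i (W t))))
      (fun t ht => (hℓ.hasDerivAt_inv _ (hSpos t)).comp t (hS t ht))
      (fun t _ => by
        have := hℓ.rate_pos _ (hSpos t)
        rw [neg_mul_neg]
        positivity) (Set.mem_Ici.2 le_rfl) (Set.mem_Ici.2 ht) ht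
  have hinner : ∀ t, 0 ≤ t → L * (g (∑ i, ℓ (p i (W t))) * F (∑ i, ℓ (p i (W t)))) ≤
      ⟪W t, descent ℓ g p (W t)⟫ := fun t ht =>
    margin_le_inner_descent hℓ hpd hL hhom _ (hF0.trans_le (hF t ht))
  have hinner_pos : ∀ t, 0 ≤ t → 0 < ⟪W t, descent ℓ g p (W t)⟫ := fun t ht =>
    lt_of_lt_of_le (mul_pos hL (mul_pos (hℓ.rate_pos _ (hSpos t)) (hF0.trans_le (hF t ht))))
      (hinner t ht)
  have hne : ∀ t : ℝ, 0 ≤ t → W t ≠ 0 ∧ descent ℓ g p (W t) ≠ 0 := fun t ht =>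
    ⟨fun h => (hinner_pos t ht).ne' (by rw [h, inner_zero_left]),
      fun h => (hinner_pos t ht).ne' (by rw [h, inner_zero_right])⟩
  refine ⟨hne, ?_⟩
  have hρpos : ∀ t, 0 ≤ t → 0 < ‖W t‖ := fun t ht => norm_pos_iff.2 (hne t ht).1
  have hNpos : ∀ t, 0 ≤ t → 0 < ‖descent ℓ g p (W t)‖ := fun t ht => norm_pos_iff.2 (hne t ht).2
  have hρ : ∀ t, 0 ≤ t → HasDerivAt (fun t => ‖W t‖)
      (⟪W t, descent ℓ g p (W t)⟫ / ‖W t‖) t := fun t ht =>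
    (hW t ht).norm_of_ne_zero (hne t ht).1
  have i₀ : ι := Classical.arbitrary ι
  have hFle : ∀ t, 0 ≤ t → F (∑ i, ℓ (p i (W t))) ≤ C₀ i₀ * ‖W t‖ ^ L := fun t ht =>
    (hℓ.inv_total_le (fun i => p i (W t)) i₀).trans
      ((Real.le_norm_self _).trans (hC₀_le i₀ _ (hne t ht).1))
  have hlim := hℓ.tendsto_radius_atTop hL (hC₀ i₀) hF0 (fun t _ => hSpos t) hρpos hρ hinner hF hFle
  have key := hℓ.tendsto_alignment (A := fun t => ‖W t‖ ^ L) (K₁ := ∑ i, C₂ i) (K₂ := ∑ i, C₁ i)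
    hL (Finset.sum_nonneg fun i _ => hC₂ i) (Finset.sum_nonneg fun i _ => hC₁ i) hS
    (fun t ht => (hasDerivAt_descent hℓ hp (hW t ht)).norm_of_ne_zero (hne t ht).2) hρ
    (fun t ht => by
      refine ((hρ t ht).rpow_const (Or.inl (hρpos t ht).ne')).congr_deriv ?_
      rw [Real.rpow_sub_one (hρpos t ht).ne']
      ring)
    (fun t _ => hSpos t) hNpos hρpos (fun t ht => Real.rpow_pos_of_pos (hρpos t ht) L)
    (fun t ht => hF0.trans_le (hF t ht))
    (fun t ht => by
      rw [abs_div, abs_norm, div_le_iff₀ (hρpos t ht), mul_comm]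
      exact abs_real_inner_le_norm _ _)
    (fun t ht => by
      rw [div_mul_cancel₀ _ (hNpos t ht).ne']
      refine (curvature_le hℓ (W t) _ rfl).trans ?_
      refine mul_le_mul_of_nonneg_right ?_ (sq_nonneg _)
      rw [mul_comm (∑ i, C₂ i), mul_assoc]
      refine mul_le_mul_of_nonneg_left ?_ (hℓ.rate_pos _ (hSpos t)).le
      rw [Finset.sum_mul]
      refine Finset.sum_le_sum fun i _ => (hC₂_le i _ (hne t ht).1).trans_eq ?_
      rw [Real.rpow_sub_one (hρpos t ht).ne', Real.rpow_sub_one (hρpos t ht).ne', div_div, sq])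
    (fun t ht => by
      have hρ0 := hρpos t ht
      have hg := hℓ.rate_pos _ (hSpos t)
      have hsum : ∑ i, ‖gradient (p i) (W t)‖ ≤ (∑ i, C₁ i) * (‖W t‖ ^ L / ‖W t‖) := by
        rw [Finset.sum_mul]
        refine Finset.sum_le_sum fun i _ => (hC₁_le i _ (hne t ht).1).trans_eq ?_
        rw [Real.rpow_sub_one hρ0.ne']
      calc _ ≤ g (∑ i, ℓ (p i (W t))) * ((∑ i, C₁ i) * (‖W t‖ ^ L / ‖W t‖)) * ‖W t‖ :=
            mul_le_mul_of_nonneg_right ((norm_descent_le hℓ _).trans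
              (mul_le_mul_of_nonneg_left hsum hg.le)) hρ0.le
        _ = _ := by
            field_simp)
    (fun t ht => (hinner t ht).trans (real_inner_le_norm _ _)) hFle hlim
  refine tendsto_of_tendsto_of_tendsto_of_le_of_le' key tendsto_const_nhds ?_ ?_
  · filter_upwards [eventually_ge_atTop 0] with t ht
    exact div_le_div_of_nonneg_right (hinner t ht) (by positivity)
  · filter_upwards with t
    exact div_le_one_of_le₀ (real_inner_le_norm _ _) (by positivity)

theorem statement_0
    (n k : ℕ) (hn : 0 < n) (L : ℝ) (hL : 0 < L)
    (p : Fin n → EuclideanSpace ℝ (Fin k) → ℝ)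
    (hp : ∀ i, ContDiff ℝ 2 (p i))
    (hhom : ∀ i (c : ℝ), 0 < c → ∀ W, p i (c • W) = c ^ L * p i W)
    (ℓ : ℝ → ℝ)
    (hℓ : ℓ = (fun z => Real.exp (-z)) ∨ ℓ = fun z => Real.log (1 + Real.exp (-z)))
    (𝓛 : EuclideanSpace ℝ (Fin k) → ℝ)
    (h𝓛 : 𝓛 = fun W => ∑ i, ℓ (p i W))
    (W : ℝ → EuclideanSpace ℝ (Fin k))
    (hW : ∀ t : ℝ, 0 ≤ t → HasDerivAt W (-gradient 𝓛 (W t)) t)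
    (hinit : 𝓛 (W 0) < ℓ 0) :
    (∀ t : ℝ, 0 ≤ t → W t ≠ 0 ∧ gradient 𝓛 (W t) ≠ 0) ∧
    Tendsto (fun t => ⟪W t, -gradient 𝓛 (W t)⟫ / (‖W t‖ * ‖gradient 𝓛 (W t)‖))
      atTop (nhds 1) := by
  obtain ⟨g, g', F, hprof⟩ : ∃ g g' F, LossProfile ℓ g g' F := by
    rcases hℓ with rfl | rfl
    · exact ⟨_, _, _, lossProfile_exp⟩
    · exact ⟨_, _, _, lossProfile_logistic⟩
  have : Nonempty (Fin n) := ⟨⟨0, hn⟩⟩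
  have hgrad : ∀ x, gradient 𝓛 x = -descent ℓ g p x := fun x => by
    rw [h𝓛]
    exact (hasGradientAt_totalLoss hprof
      (fun i => (hp i).differentiable two_ne_zero) x).gradient
  simp only [hgrad, neg_neg, norm_neg, neg_ne_zero, ne_eq] at hW ⊢
  rw [h𝓛] at hinit
  exact hprof.flow_alignment hL hp hhom hW hinit
end

section
/- Let p_1,…,p_n : ℝ^k → ℝ be twice continuously differentiable and L-positively homogeneous (L > 0), let ℓ be the exponential or logistic loss, 𝓛(W) = Σ_i ℓ(p_i(W)), α(W) = ℓ^{−1}(𝓛(W)) for 𝓛(W) < ℓ(0), and 𝓙(W) = ‖∇α(W)‖²/‖W‖^{2L−2}. Then there exists a constant K > 0 such that for every W with 𝓛(W) < ℓ(0): W ≠ 0, ∇𝓛(W) ≠ 0, and ⟨∇𝓙(W), −∇𝓛(W)⟩ ≤ −K·ℓ'(α(W))·‖W‖^{L−2}·sin²θ, where θ is the angle between W and −∇𝓛(W). -/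
open scoped RealInnerProductSpace

/-- The properties of the exponential and logistic losses used in the margin analysis. -/
structure IsMarginLoss (ℓ : ℝ → ℝ) : Prop where
  contDiff : ContDiff ℝ 2 ℓ
  pos : ∀ z, 0 < ℓ z
  deriv_neg : ∀ z, deriv ℓ z < 0
  deriv_deriv : ∀ z, deriv (deriv ℓ) z = deriv ℓ z ^ 2 * Real.exp z
  sum_exp_le : ∀ {ι : Type} (s : Finset ι) (z : ι → ℝ) (a : ℝ),
    ℓ a = ∑ i ∈ s, ℓ (z i) → ∑ i ∈ s, Real.exp (-z i) ≤ Real.exp (-a)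
  exists_inverse : ∃ ψ : ℝ → ℝ, (∀ y, 0 < y → ContDiffAt ℝ 2 ψ y) ∧ ∀ y, 0 < y → ℓ (ψ y) = y

theorem isMarginLoss_exp : IsMarginLoss (fun z => Real.exp (-z)) := by
  have hd : deriv (fun z : ℝ => Real.exp (-z)) = fun z => -Real.exp (-z) := by
    funext z
    simpa using ((hasDerivAt_neg z).exp).deriv
  refine ⟨by fun_prop, fun z => Real.exp_pos _, fun z => ?_, fun z => ?_, fun s z a h => h.ge,
    fun y => -Real.log y, fun y hy => (Real.contDiffAt_log.2 hy.ne').neg, fun y hy => ?_⟩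
  · rw [hd]
    exact neg_neg_of_pos (Real.exp_pos _)
  · rw [hd]
    have h : HasDerivAt (fun z : ℝ => -Real.exp (-z)) (Real.exp (-z)) z := by
      simpa using ((hasDerivAt_neg z).exp).fun_neg
    rw [h.deriv, neg_sq, sq, mul_assoc, ← Real.exp_add]
    simp
  · simp [Real.exp_log hy]

theorem one_add_sum_le_exp_sum_log {ι : Type*} (s : Finset ι) (x : ι → ℝ) (hx : ∀ i, 0 ≤ x i) :
    1 + ∑ i ∈ s, x i ≤ Real.exp (∑ i ∈ s, Real.log (1 + x i)) := by
  classical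
  induction s using Finset.induction_on with
  | empty => simp
  | insert i s his ih =>
    rw [Finset.sum_insert his, Finset.sum_insert his, Real.exp_add,
      Real.exp_log (by linarith [hx i])]
    have := Finset.sum_nonneg (s := s) fun j _ => hx j
    nlinarith [hx i, mul_nonneg (hx i) this, mul_le_mul_of_nonneg_left ih (hx i)]

theorem isMarginLoss_log : IsMarginLoss (fun z => Real.log (1 + Real.exp (-z))) := by
  have hpos : ∀ z : ℝ, 0 < 1 + Real.exp (-z) := fun z => by positivity
  have hd1 : ∀ z : ℝ, HasDerivAt (fun z : ℝ => 1 + Real.exp (-z)) (-Real.exp (-z)) z := fun z => by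
    simpa using ((hasDerivAt_neg z).exp).const_add 1
  have hd : deriv (fun z : ℝ => Real.log (1 + Real.exp (-z))) =
      fun z => -Real.exp (-z) / (1 + Real.exp (-z)) := by
    funext z
    exact ((hd1 z).log (hpos z).ne').deriv
  refine ⟨ContDiff.log (by fun_prop) fun z => (hpos z).ne',
    fun z => Real.log_pos (by linarith [Real.exp_pos (-z)]), fun z => ?_, fun z => ?_,
    fun s z a h => ?_, fun y => -Real.log (Real.exp y - 1), fun y hy => ?_, fun y hy => ?_⟩
  · rw [hd]
    exact div_neg_of_neg_of_pos (neg_neg_of_pos (Real.exp_pos _)) (hpos z)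
  · rw [hd]
    have h2 : HasDerivAt (fun z : ℝ => -Real.exp (-z)) (Real.exp (-z)) z := by
      simpa using ((hasDerivAt_neg z).exp).fun_neg
    rw [(h2.fun_div (hd1 z) (hpos z).ne').deriv]
    have := hpos z
    have h3 : Real.exp z = (Real.exp (-z))⁻¹ := by rw [Real.exp_neg, inv_inv]
    rw [h3]
    have := Real.exp_pos (-z)
    field_simp
    ring
  · have h1 := one_add_sum_le_exp_sum_log s (fun i => Real.exp (-z i)) fun i => (Real.exp_pos _).le
    rw [← h, Real.exp_log (hpos a)] at h1
    linarith
  · have : Real.exp y - 1 ≠ 0 := by linarith [Real.add_one_lt_exp hy.ne'] |> fun h : 0 < _ => h.ne'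
    exact (ContDiffAt.log (Real.contDiff_exp.contDiffAt.sub contDiffAt_const) this).neg
  · have : 0 < Real.exp y - 1 := by linarith [Real.add_one_lt_exp hy.ne']
    simp [Real.exp_log this]

namespace IsMarginLoss

variable {ℓ : ℝ → ℝ}

theorem strictAnti (h : IsMarginLoss ℓ) : StrictAnti ℓ := strictAnti_of_deriv_neg h.deriv_neg

theorem deriv_strictMono (h : IsMarginLoss ℓ) : StrictMono (deriv ℓ) :=
  strictMono_of_deriv_pos fun z => by
    rw [h.deriv_deriv]
    have := (h.deriv_neg z).ne
    positivity

theorem hasDerivAt (h : IsMarginLoss ℓ) (z : ℝ) : HasDerivAt ℓ (deriv ℓ z) z :=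
  (h.contDiff.differentiable (by norm_num) z).hasDerivAt

theorem hasDerivAt_deriv (h : IsMarginLoss ℓ) (z : ℝ) : HasDerivAt (deriv ℓ) (deriv ℓ z ^ 2 * Real.exp z) z := by
  rw [← h.deriv_deriv]
  have : ContDiff ℝ 1 (deriv ℓ) := by
    have := h.contDiff
    rw [show (2 : WithTop ℕ∞) = 1 + 1 by norm_num, contDiff_succ_iff_deriv] at this
    exact this.2.2
  exact (this.differentiable (by norm_num) z).hasDerivAt

theorem exp_mul_sum_sq_le (h : IsMarginLoss ℓ) {ι : Type} (s : Finset ι) (z u : ι → ℝ) (a : ℝ)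
    (ha : ℓ a = ∑ i ∈ s, ℓ (z i)) :
    Real.exp a * (∑ i ∈ s, deriv ℓ (z i) * u i) ^ 2 ≤
      ∑ i ∈ s, deriv ℓ (z i) ^ 2 * Real.exp (z i) * u i ^ 2 := by
  have h1 : (∑ i ∈ s, deriv ℓ (z i) * u i) ^ 2 ≤
      (∑ i ∈ s, deriv ℓ (z i) ^ 2 * Real.exp (z i) * u i ^ 2) * ∑ i ∈ s, Real.exp (-z i) := by
    refine Finset.sum_sq_le_sum_mul_sum_of_sq_le_mul s (fun i _ => by positivity)
      (fun i _ => by positivity) fun i _ => le_of_eq ?_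
    rw [Real.exp_neg]
    field_simp
  have h2 := h.sum_exp_le s z a ha
  have h3 : 0 ≤ ∑ i ∈ s, deriv ℓ (z i) ^ 2 * Real.exp (z i) * u i ^ 2 :=
    Finset.sum_nonneg fun i _ => by positivity
  calc _ ≤ Real.exp a * ((∑ i ∈ s, deriv ℓ (z i) ^ 2 * Real.exp (z i) * u i ^ 2) *
        Real.exp (-a)) := by gcongr; exact h1.trans (by gcongr)
    _ = _ := by rw [Real.exp_neg]; field_simp

end IsMarginLoss

section Homogeneous

variable {E F : Type*} [NormedAddCommGroup E] [NormedSpace ℝ E]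
  [NormedAddCommGroup F] [NormedSpace ℝ F]

theorem fderiv_smul_of_homogeneous {f : E → F} {m : ℝ} (hf : Differentiable ℝ f)
    (hom : ∀ c : ℝ, 0 < c → ∀ x, f (c • x) = c ^ m • f x) (c : ℝ) (hc : 0 < c) (x : E) :
    fderiv ℝ f (c • x) = c ^ (m - 1) • fderiv ℝ f x := by
  have h1 : HasFDerivAt (fun x => f (c • x))
      ((fderiv ℝ f (c • x)).comp (c • ContinuousLinearMap.id ℝ E)) x :=
    (hf (c • x)).hasFDerivAt.comp x ((hasFDerivAt_id x).const_smul c)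
  have h2 : HasFDerivAt (fun x => f (c • x)) (c ^ m • fderiv ℝ f x) x := by
    simp_rw [hom c hc]
    exact (hf x).hasFDerivAt.const_smul _
  ext v
  have h3 := DFunLike.congr_fun (h1.unique h2) v
  simp only [ContinuousLinearMap.comp_apply, _root_.smul_apply,
    ContinuousLinearMap.id_apply, map_smul] at h3 ⊢
  rw [Real.rpow_sub hc, Real.rpow_one, div_eq_inv_mul, mul_smul, ← h3, smul_smul,
    inv_mul_cancel₀ hc.ne', one_smul]

theorem fderiv_apply_self_of_homogeneous {f : E → F} {m : ℝ} (hf : Differentiable ℝ f)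
    (hom : ∀ c : ℝ, 0 < c → ∀ x, f (c • x) = c ^ m • f x) (x : E) :
    fderiv ℝ f x x = m • f x := by
  have h1 : HasDerivAt (fun t : ℝ => f (t • x)) (fderiv ℝ f ((1 : ℝ) • x) ((1 : ℝ) • x)) 1 :=
    (hf _).hasFDerivAt.comp_hasDerivAt (1 : ℝ) ((hasDerivAt_id (1 : ℝ)).smul_const x)
  have h2 : HasDerivAt (fun t : ℝ => t ^ m • f x) (m • f x) 1 := by
    simpa using (Real.hasDerivAt_rpow_const (x := 1) (p := m) (by simp)).smul_const (f x)
  have h3 : (fun t : ℝ => f (t • x)) =ᶠ[nhds 1] fun t => t ^ m • f x := by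
    filter_upwards [lt_mem_nhds one_pos] with t ht using hom t ht x
  simpa using h1.unique (h2.congr_of_eventuallyEq h3)

theorem exists_norm_le_of_homogeneous_s12 [FiniteDimensional ℝ E] {f : E → F} {m : ℝ}
    (hf : Continuous f) (hom : ∀ c : ℝ, 0 < c → ∀ x, f (c • x) = c ^ m • f x) :
    ∃ C : ℝ, ∀ x, x ≠ 0 → ‖f x‖ ≤ C * ‖x‖ ^ m := by
  obtain ⟨C, hC⟩ := (isCompact_sphere (0 : E) 1).exists_bound_of_continuousOn hf.continuousOn
  refine ⟨C, fun x hx => ?_⟩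
  have hx' := norm_pos_iff.2 hx
  have h1 : x = ‖x‖ • (‖x‖⁻¹ • x) := by rw [smul_smul, mul_inv_cancel₀ hx'.ne', one_smul]
  have h2 := hC (‖x‖⁻¹ • x) (by simp [norm_smul, hx'.ne'])
  have h3 : ‖f x‖ = ‖x‖ ^ m * ‖f (‖x‖⁻¹ • x)‖ := by
    conv_lhs => rw [h1, hom _ hx', norm_smul, Real.norm_of_nonneg (by positivity)]
  rw [h3, mul_comm]
  gcongr

end Homogeneous

section Gradient

variable {E : Type*} [NormedAddCommGroup E] [InnerProductSpace ℝ E] [CompleteSpace E]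

theorem contDiff_gradient_s12 {f : E → ℝ} (hf : ContDiff ℝ 2 f) : ContDiff ℝ 1 (gradient f) :=
  (InnerProductSpace.toDual ℝ E).symm.contDiff.comp (hf.fderiv_right (by norm_num))

theorem gradient_smul_of_homogeneous {f : E → ℝ} {m : ℝ} (hf : Differentiable ℝ f)
    (hom : ∀ c : ℝ, 0 < c → ∀ x, f (c • x) = c ^ m * f x) (c : ℝ) (hc : 0 < c) (x : E) :
    gradient f (c • x) = c ^ (m - 1) • gradient f x := by
  simp only [gradient, fderiv_smul_of_homogeneous hf hom c hc x, map_smulₛₗ]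
  simp

theorem inner_gradient_self_of_homogeneous {f : E → ℝ} {m : ℝ} (hf : Differentiable ℝ f)
    (hom : ∀ c : ℝ, 0 < c → ∀ x, f (c • x) = c ^ m * f x) (x : E) :
    ⟪gradient f x, x⟫ = m * f x := by
  rw [inner_gradient_left, fderiv_apply_self_of_homogeneous hf hom, smul_eq_mul]

theorem inner_fderiv_gradient_self_of_homogeneous {f : E → ℝ} {m : ℝ} (hf : ContDiff ℝ 2 f)
    (hom : ∀ c : ℝ, 0 < c → ∀ x, f (c • x) = c ^ m * f x) (x v : E) :
    ⟪fderiv ℝ (gradient f) x v, x⟫ = (m - 1) * ⟪gradient f x, v⟫ := by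
  have hd := hf.differentiable (by norm_num)
  have h1 := ((contDiff_gradient_s12 hf).differentiable (by norm_num) x).hasFDerivAt.inner ℝ
    (hasFDerivAt_id x)
  have h2 : HasFDerivAt (fun x => ⟪gradient f x, id x⟫) (m • fderiv ℝ f x) x := by
    simp_rw [id, inner_gradient_self_of_homogeneous hd hom]
    exact (hd x).hasFDerivAt.const_mul m
  have h3 := DFunLike.congr_fun (h1.unique h2) v
  simp [fderivInnerCLM_apply, ← inner_gradient_left] at h3
  linarith

/-- The second derivative of a homogeneous function in the direction `a • x + v`. -/
theorem inner_fderiv_gradient_add_of_homogeneous {f : E → ℝ} {m : ℝ} (hf : ContDiff ℝ 2 f)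
    (hom : ∀ c : ℝ, 0 < c → ∀ x, f (c • x) = c ^ m * f x) (x v : E) (a : ℝ) :
    ⟪fderiv ℝ (gradient f) x (a • x + v), a • x + v⟫ =
      a ^ 2 * (m - 1) * ⟪gradient f x, x⟫ + 2 * a * (m - 1) * ⟪gradient f x, v⟫ +
        ⟪fderiv ℝ (gradient f) x v, v⟫ := by
  have h1 := inner_fderiv_gradient_self_of_homogeneous hf hom x v
  have h2 : fderiv ℝ (gradient f) x x = (m - 1) • gradient f x :=
    fderiv_apply_self_of_homogeneous ((contDiff_gradient_s12 hf).differentiable (by norm_num))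
      (gradient_smul_of_homogeneous (hf.differentiable (by norm_num)) hom) x
  simp only [map_add, map_smul, h2, inner_add_left, inner_add_right, inner_smul_left,
    inner_smul_right, h1]
  simp
  ring

theorem inner_gradient_normSq_gradient_div {α : E → ℝ} (hα : ContDiff ℝ 2 α) (m : ℝ)
    {x : E} (hx : x ≠ 0) (v : E) :
    ⟪gradient (fun y => ‖gradient α y‖ ^ 2 / ‖y‖ ^ (2 * m - 2)) x, v⟫ =
      2 * (⟪gradient α x, fderiv ℝ (gradient α) x v⟫ * ‖x‖ ^ 2 -
        (m - 1) * ‖gradient α x‖ ^ 2 * ⟪x, v⟫) / ((‖x‖ ^ (m - 2)) ^ 2 * ‖x‖ ^ 4) := by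
  have hx' := norm_pos_iff.2 hx
  have hG := (contDiff_gradient_s12 hα).differentiable (by norm_num)
  have heq : (fun y => ‖gradient α y‖ ^ 2 / ‖y‖ ^ (2 * m - 2)) =
      fun y => ‖gradient α y‖ ^ 2 / (‖y‖ ^ 2) ^ (m - 1) := by
    funext y
    rw [← Real.rpow_natCast ‖y‖ 2, ← Real.rpow_mul (norm_nonneg _)]
    congr 2
    push_cast
    ring
  have hdiff : DifferentiableAt ℝ (fun y => ‖gradient α y‖ ^ 2 / (‖y‖ ^ 2) ^ (m - 1)) x := by
    have h1 : 0 < (‖x‖ ^ 2) ^ (m - 1) := Real.rpow_pos_of_pos (by positivity) _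
    have h2 : DifferentiableAt ℝ (fun y : E => (‖y‖ ^ 2) ^ (m - 1)) x :=
      (differentiableAt_fun_id.norm_sq ℝ).rpow_const (Or.inl (by simpa using hx))
    simp_rw [div_eq_mul_inv]
    exact ((hG x).norm_sq ℝ).fun_mul (h2.fun_inv h1.ne')
  have hline : HasDerivAt (fun t : ℝ => x + t • v) v 0 := by
    simpa using ((hasDerivAt_id (0 : ℝ)).smul_const v).const_add x
  have hx0 : x + (0 : ℝ) • v = x := by simp
  have h1 : HasDerivAt (fun t : ℝ => gradient α (x + t • v)) (fderiv ℝ (gradient α) x v) 0 := by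
    have := (hG (x + (0 : ℝ) • v)).hasFDerivAt.comp_hasDerivAt (0 : ℝ) hline
    rwa [hx0] at this
  have h2 := h1.norm_sq.fun_div (hline.norm_sq.rpow_const (p := m - 1) (Or.inl (by simpa using hx)))
    (Real.rpow_pos_of_pos (by rw [hx0]; positivity) _).ne'
  have h3 : HasDerivAt (fun t : ℝ => ‖gradient α (x + t • v)‖ ^ 2 / (‖x + t • v‖ ^ 2) ^ (m - 1))
      (fderiv ℝ (fun y => ‖gradient α y‖ ^ 2 / (‖y‖ ^ 2) ^ (m - 1)) x v) 0 := by
    have := HasFDerivAt.comp_hasDerivAt (f := fun t : ℝ => x + t • v) (0 : ℝ)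
      (by rw [hx0]; exact hdiff.hasFDerivAt) hline
    exact this
  rw [heq, inner_gradient_left, h3.unique h2]
  simp only [hx0]
  have e1 : (‖x‖ ^ 2) ^ (m - 1 - 1) = (‖x‖ ^ (m - 2)) ^ 2 := by
    rw [← Real.rpow_natCast ‖x‖ 2, ← Real.rpow_natCast _ 2, ← Real.rpow_mul (norm_nonneg _),
      ← Real.rpow_mul (norm_nonneg _)]
    congr 1
    push_cast
    ring
  have e2 : (‖x‖ ^ 2) ^ (m - 1) = (‖x‖ ^ (m - 2)) ^ 2 * ‖x‖ ^ 2 := by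
    rw [← e1, Real.rpow_sub_one (by positivity) (m - 1)]
    field_simp
  have hR : 0 < ‖x‖ ^ (m - 2) := Real.rpow_pos_of_pos hx' _
  rw [e1, e2]
  field_simp

end Gradient

theorem exists_contDiff_smoothedMargin {E : Type*} [NormedAddCommGroup E]
    [NormedSpace ℝ E] {n : ℕ} {ℓ : ℝ → ℝ} {p : Fin n → E → ℝ} (h : IsMarginLoss ℓ) (hn : 0 < n)
    (hp : ∀ i, ContDiff ℝ 2 (p i)) :
    ContDiff ℝ 2 (fun x => Function.invFun ℓ (∑ i, ℓ (p i x))) ∧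
      ∀ x, ℓ (Function.invFun ℓ (∑ i, ℓ (p i x))) = ∑ i, ℓ (p i x) := by
  obtain ⟨ψ, hψ, hψ'⟩ := h.exists_inverse
  have hpos : ∀ x, 0 < ∑ i, ℓ (p i x) := fun x =>
    Finset.sum_pos (fun i _ => h.pos _) ⟨⟨0, hn⟩, Finset.mem_univ _⟩
  have hinv : ∀ x, Function.invFun ℓ (∑ i, ℓ (p i x)) = ψ (∑ i, ℓ (p i x)) := fun x => by
    conv_lhs => rw [← hψ' _ (hpos x)]
    exact Function.leftInverse_invFun h.strictAnti.injective _
  refine ⟨?_, fun x => by rw [hinv, hψ' _ (hpos x)]⟩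
  simp_rw [hinv]
  refine contDiff_iff_contDiffAt.2 fun x => (hψ _ (hpos x)).comp x (f := fun x => ∑ i, ℓ (p i x)) ?_
  exact (ContDiff.sum fun i _ => h.contDiff.comp (hp i)).contDiffAt

section SmoothedMargin

variable {E : Type*} [NormedAddCommGroup E] [InnerProductSpace ℝ E] [CompleteSpace E]
  {n : ℕ} {ℓ : ℝ → ℝ} {p : Fin n → E → ℝ} {α : E → ℝ}

theorem IsMarginLoss.gradient_comp (h : IsMarginLoss ℓ) {f : E → ℝ} (hf : Differentiable ℝ f)
    (x : E) : gradient (fun y => ℓ (f y)) x = deriv ℓ (f x) • gradient f x := by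
  refine HasGradientAt.gradient ?_
  rw [hasGradientAt_iff_hasFDerivAt]
  have h1 := (h.hasDerivAt (f x)).comp_hasFDerivAt x (hf x).hasFDerivAt
  rwa [map_smulₛₗ, toDual_gradient]

theorem IsMarginLoss.smul_gradient_eq_sum (h : IsMarginLoss ℓ) (hα : Differentiable ℝ α)
    (hp : ∀ i, Differentiable ℝ (p i)) (heq : ∀ x, ℓ (α x) = ∑ i, ℓ (p i x)) (x : E) :
    deriv ℓ (α x) • gradient α x = ∑ i, deriv ℓ (p i x) • gradient (p i) x := by
  rw [← h.gradient_comp hα, funext heq,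
    Finset.sum_congr rfl fun i _ => (h.gradient_comp (hp i) x).symm]
  have hd : ∀ i, DifferentiableAt ℝ (fun y => ℓ (p i y)) x := fun i =>
    (h.contDiff.differentiable (by norm_num) _).comp x (hp i x)
  simp only [gradient]
  rw [fderiv_fun_sum fun i _ => hd i, map_sum]

theorem IsMarginLoss.hasFDerivAt_deriv_smul_gradient (h : IsMarginLoss ℓ) {f : E → ℝ}
    (hf : ContDiff ℝ 2 f) (x : E) :
    HasFDerivAt (fun y => deriv ℓ (f y) • gradient f y)
      (deriv ℓ (f x) • fderiv ℝ (gradient f) x +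
        ((deriv ℓ (f x) ^ 2 * Real.exp (f x)) • fderiv ℝ f x).smulRight (gradient f x)) x :=
  ((h.hasDerivAt_deriv (f x)).comp_hasFDerivAt x
    (hf.differentiable (by norm_num) x).hasFDerivAt).fun_smul
    ((contDiff_gradient_s12 hf).differentiable (by norm_num) x).hasFDerivAt

/-- Concavity of the soft minimum: the Hessian of the smoothed margin is dominated by the weighted
Hessians of the individual margins. -/
theorem IsMarginLoss.sum_inner_fderiv_gradient_le (h : IsMarginLoss ℓ) (hα : ContDiff ℝ 2 α)
    (hp : ∀ i, ContDiff ℝ 2 (p i)) (heq : ∀ x, ℓ (α x) = ∑ i, ℓ (p i x)) (x v : E) :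
    ∑ i, deriv ℓ (p i x) * ⟪fderiv ℝ (gradient (p i)) x v, v⟫ ≤
      deriv ℓ (α x) * ⟪fderiv ℝ (gradient α) x v, v⟫ := by
  have hg := h.smul_gradient_eq_sum (hα.differentiable (by norm_num))
    (fun i => (hp i).differentiable (by norm_num)) heq
  have h1 := h.hasFDerivAt_deriv_smul_gradient hα x
  simp_rw [hg] at h1
  have h2 := HasFDerivAt.fun_sum (u := Finset.univ) fun i _ =>
    h.hasFDerivAt_deriv_smul_gradient (hp i) x
  have h3 := congrArg (fun w => ⟪w, v⟫) (DFunLike.congr_fun (h1.unique h2) v)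
  simp only [_root_.add_apply, _root_.smul_apply, ContinuousLinearMap.smulRight_apply,
    _root_.sum_apply, sum_inner, inner_add_left, real_inner_smul_left,
    ← inner_gradient_left, smul_eq_mul, Finset.sum_add_distrib] at h3
  have h4 := h.exp_mul_sum_sq_le Finset.univ (fun i => p i x) (fun i => ⟪gradient (p i) x, v⟫)
    (α x) (heq x)
  have h5 := congrArg (fun w => ⟪w, v⟫) (hg x)
  simp only [sum_inner, real_inner_smul_left] at h5
  rw [← h5] at h4
  have h6 : ∑ i, deriv ℓ (p i x) ^ 2 * Real.exp (p i x) * ⟪gradient (p i) x, v⟫ *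
      ⟪gradient (p i) x, v⟫ =
      ∑ i, deriv ℓ (p i x) ^ 2 * Real.exp (p i x) * ⟪gradient (p i) x, v⟫ ^ 2 :=
    Finset.sum_congr rfl fun i _ => by ring
  rw [h6] at h3
  linarith

theorem IsMarginLoss.le_of_eq_sum (h : IsMarginLoss ℓ) {z : Fin n → ℝ} {a : ℝ}
    (ha : ℓ a = ∑ i, ℓ (z i)) (i : Fin n) : a ≤ z i := by
  rw [← h.strictAnti.le_iff_ge, ha]
  exact Finset.single_le_sum (fun j _ => (h.pos (z j)).le) (Finset.mem_univ i)

theorem IsMarginLoss.div_deriv_mem_Ioc (h : IsMarginLoss ℓ) {a z : ℝ} (haz : a ≤ z) :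
    0 < deriv ℓ z / deriv ℓ a ∧ deriv ℓ z / deriv ℓ a ≤ 1 := by
  refine ⟨div_pos_of_neg_of_neg (h.deriv_neg _) (h.deriv_neg _), ?_⟩
  rw [div_le_one_of_neg (h.deriv_neg _)]
  exact h.deriv_strictMono.monotone haz

theorem IsMarginLoss.gradient_eq_sum (h : IsMarginLoss ℓ) (hα : Differentiable ℝ α)
    (hp : ∀ i, Differentiable ℝ (p i)) (heq : ∀ x, ℓ (α x) = ∑ i, ℓ (p i x)) (x : E) :
    gradient α x = ∑ i, (deriv ℓ (p i x) / deriv ℓ (α x)) • gradient (p i) x := by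
  have h1 := h.smul_gradient_eq_sum hα hp heq x
  simp_rw [div_eq_inv_mul, mul_smul]
  rw [← Finset.smul_sum, ← h1, smul_smul, inv_mul_cancel₀ (h.deriv_neg _).ne, one_smul]

/-- The estimate for the derivative of the normalized squared gradient of the smoothed margin,
in terms of the component of the gradient orthogonal to `x`. -/
theorem IsMarginLoss.inner_gradient_normSq_div_le (h : IsMarginLoss ℓ) (hn : 0 < n) {m C : ℝ}
    (hα : ContDiff ℝ 2 α) (hp : ∀ i, ContDiff ℝ 2 (p i))
    (hom : ∀ i (c : ℝ), 0 < c → ∀ x, p i (c • x) = c ^ m * p i x)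
    (heq : ∀ x, ℓ (α x) = ∑ i, ℓ (p i x)) {x : E} (hx : x ≠ 0) (hC : 0 < C)
    (hC1 : ∀ i, ‖gradient (p i) x‖ ≤ C * ‖x‖ ^ (m - 1))
    (hC2 : ∀ i, ‖fderiv ℝ (gradient (p i)) x‖ ≤ C * ‖x‖ ^ (m - 2))
    (hg : gradient α x ≠ 0) :
    ⟪gradient (fun y => ‖gradient α y‖ ^ 2 / ‖y‖ ^ (2 * m - 2)) x, gradient α x⟫ ≤
      2 * (|m - 1| + 1) * (n * C) ^ 3 * ‖x‖ ^ (m - 2) *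
        (1 - (⟪x, gradient α x⟫ / (‖x‖ * ‖gradient α x‖)) ^ 2) := by
  rw [inner_gradient_normSq_gradient_div hα m hx]
  have hx' := norm_pos_iff.2 hx
  have hg' := norm_pos_iff.2 hg
  have hR : 0 < ‖x‖ ^ (m - 2) := Real.rpow_pos_of_pos hx' _
  have hRx : ‖x‖ ^ (m - 1) = ‖x‖ ^ (m - 2) * ‖x‖ := by
    rw [← Real.rpow_add_one hx'.ne']
    congr 1
    ring
  have hq := fun i => h.div_deriv_mem_Ioc (h.le_of_eq_sum (heq x) i)
  have hgs := h.gradient_eq_sum (hα.differentiable (by norm_num))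
    (fun i => (hp i).differentiable (by norm_num)) heq x
  have hH := h.sum_inner_fderiv_gradient_le hα hp heq x (gradient α x)
  have hH' : ⟪gradient α x, fderiv ℝ (gradient α) x (gradient α x)⟫ ≤
      ∑ i, deriv ℓ (p i x) / deriv ℓ (α x) *
        ⟪fderiv ℝ (gradient (p i)) x (gradient α x), gradient α x⟫ := by
    rw [real_inner_comm]
    simp_rw [div_mul_eq_mul_div]
    rw [← Finset.sum_div, le_div_iff_of_neg (h.deriv_neg _), mul_comm]
    exact hH
  clear hH
  set g := gradient α x with hgdef
  set q : Fin n → ℝ := fun i => deriv ℓ (p i x) / deriv ℓ (α x) with hqdef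
  change g = ∑ i, q i • gradient (p i) x at hgs
  change _ ≤ ∑ i, q i * _ at hH'
  change ∀ i, 0 < q i ∧ q i ≤ 1 at hq
  set M := ⟪g, fderiv ℝ (gradient α) x g⟫
  set R := ‖x‖ ^ (m - 2)
  set ρ := ‖x‖ with hρ
  set a := ⟪x, g⟫ / ρ ^ 2 with ha
  set v := g - a • x with hv
  have hb : ⟪x, g⟫ = a * ρ ^ 2 := by rw [ha]; field_simp
  have hgv : g = a • x + v := by rw [hv]; abel
  have hxv : ⟪x, v⟫ = 0 := by
    rw [hv, inner_sub_right, hb, real_inner_smul_right, real_inner_self_eq_norm_sq]; ring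
  have hvv : ⟪g, v⟫ = ‖v‖ ^ 2 := by
    conv_lhs => rw [hgv]
    rw [inner_add_left, real_inner_smul_left, hxv, real_inner_self_eq_norm_sq]; ring
  have hnorm : ‖g‖ ^ 2 = a ^ 2 * ρ ^ 2 + ‖v‖ ^ 2 := by
    have : ⟪g, g⟫ = a * ⟪x, g⟫ + ⟪g, v⟫ := by
      conv_lhs => rw [hgv, inner_add_left, real_inner_smul_left, ← hgv]
      rw [real_inner_comm v g]
    rw [← real_inner_self_eq_norm_sq, this, hb, hvv]; ring
  have hgle : ‖g‖ ≤ n * C * (R * ρ) := by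
    rw [hgs]
    calc _ ≤ ∑ i : Fin n, C * (R * ρ) := norm_sum_le_of_le _ fun i _ => by
            rw [norm_smul, Real.norm_of_nonneg (hq i).1.le, ← hRx]
            calc _ ≤ 1 * ‖gradient (p i) x‖ := by gcongr; exact (hq i).2
              _ ≤ _ := by rw [one_mul]; exact hC1 i
      _ = _ := by simp; ring
  have hale : |a| ≤ n * C * R := by
    have h1 := abs_real_inner_le_norm x g
    rw [hb, abs_mul, abs_of_pos (by positivity : 0 < ρ ^ 2)] at h1
    have h2 : |a| * ρ ^ 2 ≤ n * C * R * ρ ^ 2 :=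
      calc _ ≤ ρ * ‖g‖ := h1
        _ ≤ ρ * (n * C * (R * ρ)) := by gcongr
        _ = _ := by ring
    exact le_of_mul_le_mul_right h2 (by positivity)
  have hM : M ≤ a ^ 3 * (m - 1) * ρ ^ 2 + 2 * a * (m - 1) * ‖v‖ ^ 2 + n * C * R * ‖v‖ ^ 2 := by
    have e1 : ∑ i, q i * ⟪gradient (p i) x, x⟫ = a * ρ ^ 2 := by
      rw [← hb, real_inner_comm, hgs, sum_inner]
      simp_rw [real_inner_smul_left]
    have e2 : ∑ i, q i * ⟪gradient (p i) x, v⟫ = ‖v‖ ^ 2 := by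
      rw [← hvv]
      conv_rhs => rw [hgs, sum_inner]
      simp_rw [real_inner_smul_left]
    have e3 : ∑ i, q i * ⟪fderiv ℝ (gradient (p i)) x v, v⟫ ≤ n * C * R * ‖v‖ ^ 2 := by
      calc _ ≤ ∑ i : Fin n, C * R * ‖v‖ ^ 2 := Finset.sum_le_sum fun i _ => ?_
        _ = _ := by simp; ring
      have h1 : ⟪fderiv ℝ (gradient (p i)) x v, v⟫ ≤ C * R * ‖v‖ ^ 2 :=
        calc _ ≤ ‖fderiv ℝ (gradient (p i)) x v‖ * ‖v‖ := real_inner_le_norm _ _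
          _ ≤ C * R * ‖v‖ * ‖v‖ := by
            gcongr
            exact (ContinuousLinearMap.le_opNorm _ _).trans (by gcongr; exact hC2 i)
          _ = _ := by ring
      calc _ ≤ q i * (C * R * ‖v‖ ^ 2) := mul_le_mul_of_nonneg_left h1 (hq i).1.le
        _ ≤ 1 * (C * R * ‖v‖ ^ 2) := by gcongr; exact (hq i).2
        _ = _ := one_mul _
    calc M ≤ _ := hH'
      _ = ∑ i, (a ^ 2 * (m - 1) * (q i * ⟪gradient (p i) x, x⟫) +
          2 * a * (m - 1) * (q i * ⟪gradient (p i) x, v⟫) +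
          q i * ⟪fderiv ℝ (gradient (p i)) x v, v⟫) := Finset.sum_congr rfl fun i _ => by
            rw [hgv, inner_fderiv_gradient_add_of_homogeneous (hp i) (hom i)]; ring
      _ = a ^ 2 * (m - 1) * (a * ρ ^ 2) + 2 * a * (m - 1) * ‖v‖ ^ 2 +
          ∑ i, q i * ⟪fderiv ℝ (gradient (p i)) x v, v⟫ := by
            rw [Finset.sum_add_distrib, Finset.sum_add_distrib, ← Finset.mul_sum,
              ← Finset.mul_sum, e1, e2]
      _ ≤ _ := by linarith
  have hsin : 1 - (⟪x, g⟫ / (ρ * ‖g‖)) ^ 2 = ‖v‖ ^ 2 / ‖g‖ ^ 2 := by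
    rw [hb, eq_sub_of_add_eq' hnorm.symm]
    field_simp
  rw [hsin, hb]
  have ham : a * (m - 1) ≤ n * C * R * |m - 1| := by
    calc _ ≤ |a * (m - 1)| := le_abs_self _
      _ = |a| * |m - 1| := abs_mul _ _
      _ ≤ _ := by gcongr
  have hnum : M * ρ ^ 2 - (m - 1) * ‖g‖ ^ 2 * (a * ρ ^ 2) ≤
      ρ ^ 2 * ((|m - 1| + 1) * (n * C * R) * ‖v‖ ^ 2) := by
    have h1 : M - (m - 1) * ‖g‖ ^ 2 * a ≤ (|m - 1| + 1) * (n * C * R) * ‖v‖ ^ 2 := by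
      rw [hnorm]
      linarith [mul_le_mul_of_nonneg_right ham (sq_nonneg ‖v‖)]
    linarith [mul_le_mul_of_nonneg_left h1 (sq_nonneg ρ)]
  have hn' : (0 : ℝ) < n := by exact_mod_cast hn
  calc _ ≤ 2 * (ρ ^ 2 * ((|m - 1| + 1) * (n * C * R) * ‖v‖ ^ 2)) / (R ^ 2 * ρ ^ 4) := by gcongr
    _ = 2 * (|m - 1| + 1) * (n * C) * ‖v‖ ^ 2 / (R * ρ ^ 2) := by field_simp
    _ = 2 * (|m - 1| + 1) * (n * C) * ‖v‖ ^ 2 / (R * ρ ^ 2 * ‖g‖ ^ 2) * ‖g‖ ^ 2 := by field_simp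
    _ ≤ 2 * (|m - 1| + 1) * (n * C) * ‖v‖ ^ 2 / (R * ρ ^ 2 * ‖g‖ ^ 2) *
        (n * C * (R * ρ)) ^ 2 := by gcongr
    _ = _ := by field_simp

end SmoothedMargin

theorem exists_uniform_derivative_bounds {E : Type*} [NormedAddCommGroup E]
    [InnerProductSpace ℝ E] [FiniteDimensional ℝ E] [CompleteSpace E] {n : ℕ} {m : ℝ}
    {p : Fin n → E → ℝ} (hp : ∀ i, ContDiff ℝ 2 (p i))
    (hom : ∀ i (c : ℝ), 0 < c → ∀ x, p i (c • x) = c ^ m * p i x) :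
    ∃ C : ℝ, 0 < C ∧ ∀ i x, x ≠ 0 → ‖gradient (p i) x‖ ≤ C * ‖x‖ ^ (m - 1) ∧
      ‖fderiv ℝ (gradient (p i)) x‖ ≤ C * ‖x‖ ^ (m - 2) := by
  have hhom1 := fun i =>
    gradient_smul_of_homogeneous ((hp i).differentiable (by norm_num)) (hom i)
  have hhom2 : ∀ i (c : ℝ), 0 < c → ∀ x, fderiv ℝ (gradient (p i)) (c • x) =
      c ^ (m - 2) • fderiv ℝ (gradient (p i)) x := fun i c hc x => by
    rw [fderiv_smul_of_homogeneous ((contDiff_gradient_s12 (hp i)).differentiable (by norm_num))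
      (hhom1 i) c hc x]
    congr 2
    ring
  choose A hA using fun i => exists_norm_le_of_homogeneous_s12 (contDiff_gradient_s12 (hp i)).continuous
    (hhom1 i)
  choose B hB using fun i => exists_norm_le_of_homogeneous_s12
    ((contDiff_gradient_s12 (hp i)).continuous_fderiv (by norm_num)) (hhom2 i)
  have hle : ∀ i, |A i| + |B i| ≤ ∑ j, (|A j| + |B j|) := fun i =>
    Finset.single_le_sum (f := fun j => |A j| + |B j|) (fun j _ => by positivity)
      (Finset.mem_univ i)
  refine ⟨∑ j, (|A j| + |B j|) + 1, by positivity, fun i x hx => ⟨(hA i x hx).trans ?_,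
    (hB i x hx).trans ?_⟩⟩
  · gcongr
    linarith [hle i, le_abs_self (A i), abs_nonneg (B i)]
  · gcongr
    linarith [hle i, le_abs_self (B i), abs_nonneg (A i)]

theorem statement_12
    (n k : ℕ) (hn : 0 < n) (L : ℝ) (hL : 0 < L)
    (p : Fin n → EuclideanSpace ℝ (Fin k) → ℝ)
    (hp : ∀ i, ContDiff ℝ 2 (p i))
    (hhom : ∀ i (c : ℝ), 0 < c → ∀ W, p i (c • W) = c ^ L * p i W)
    (ℓ : ℝ → ℝ)
    (hℓ : ℓ = (fun z => Real.exp (-z)) ∨ ℓ = fun z => Real.log (1 + Real.exp (-z)))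
    (𝓛 : EuclideanSpace ℝ (Fin k) → ℝ)
    (h𝓛 : 𝓛 = fun W => ∑ i, ℓ (p i W))
    (α : EuclideanSpace ℝ (Fin k) → ℝ)
    (hα : α = fun W => Function.invFun ℓ (𝓛 W))
    (𝓙 : EuclideanSpace ℝ (Fin k) → ℝ)
    (h𝓙 : 𝓙 = fun W => ‖gradient α W‖ ^ 2 / ‖W‖ ^ (2 * L - 2)) :
    ∃ K : ℝ, 0 < K ∧ ∀ W : EuclideanSpace ℝ (Fin k), 𝓛 W < ℓ 0 →
      W ≠ 0 ∧ gradient 𝓛 W ≠ 0 ∧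
      ⟪gradient 𝓙 W, -gradient 𝓛 W⟫ ≤
        -K * deriv ℓ (α W) * ‖W‖ ^ (L - 2) *
          (1 - (⟪W, -gradient 𝓛 W⟫ / (‖W‖ * ‖gradient 𝓛 W‖)) ^ 2) := by
  have h : IsMarginLoss ℓ := by
    rcases hℓ with rfl | rfl
    · exact isMarginLoss_exp
    · exact isMarginLoss_log
  obtain ⟨hα2, heq⟩ : ContDiff ℝ 2 α ∧ ∀ x, ℓ (α x) = ∑ i, ℓ (p i x) := by
    subst hα h𝓛
    exact exists_contDiff_smoothedMargin h hn hp
  have hαd := hα2.differentiable (by norm_num)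
  have hpd := fun i => (hp i).differentiable (by norm_num)
  have h𝓛α : 𝓛 = fun x => ℓ (α x) := by
    rw [h𝓛]
    funext x
    exact (heq x).symm
  obtain ⟨C, hC, hbound⟩ := exists_uniform_derivative_bounds hp hhom
  have hn' : (0 : ℝ) < n := by exact_mod_cast hn
  refine ⟨2 * (|L - 1| + 1) * (n * C) ^ 3, by positivity, fun W hW => ?_⟩
  have hgrad : gradient 𝓛 W = deriv ℓ (α W) • gradient α W := by
    rw [h𝓛α, h.gradient_comp hαd]
  have hαpos : 0 < α W := by
    rw [h𝓛α] at hW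
    exact h.strictAnti.lt_iff_gt.1 hW
  have hppos : ∀ i, 0 < p i W := fun i => hαpos.trans_le (h.le_of_eq_sum (heq W) i)
  have hinner : 0 < ⟪gradient α W, W⟫ := by
    rw [h.gradient_eq_sum hαd hpd heq W, sum_inner]
    refine Finset.sum_pos (fun i _ => ?_) ⟨⟨0, hn⟩, Finset.mem_univ _⟩
    rw [real_inner_smul_left, inner_gradient_self_of_homogeneous (hpd i) (hhom i)]
    exact mul_pos (h.div_deriv_mem_Ioc (h.le_of_eq_sum (heq W) i)).1 (mul_pos hL (hppos i))
  have hW0 : W ≠ 0 := by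
    rintro rfl
    simp at hinner
  have hg0 : gradient α W ≠ 0 := by
    intro h0
    simp [h0] at hinner
  have hneg := h.deriv_neg (α W)
  refine ⟨hW0, ?_, ?_⟩
  · rw [hgrad]
    exact smul_ne_zero hneg.ne hg0
  have hmain := h.inner_gradient_normSq_div_le hn hα2 hp hhom heq hW0 hC
    (fun i => (hbound i W hW0).1) (fun i => (hbound i W hW0).2) hg0
  rw [← h𝓙] at hmain
  have hcos : ⟪W, -gradient 𝓛 W⟫ / (‖W‖ * ‖gradient 𝓛 W‖) =
      ⟪W, gradient α W⟫ / (‖W‖ * ‖gradient α W‖) := by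
    have h1 := norm_pos_iff.2 hW0
    have h2 := norm_pos_iff.2 hg0
    rw [hgrad, ← neg_smul, real_inner_smul_right, norm_smul, Real.norm_of_nonpos hneg.le]
    have h3 := neg_pos.2 hneg
    rw [mul_left_comm, mul_div_mul_left _ _ h3.ne']
  rw [hcos, hgrad, ← neg_smul, real_inner_smul_right]
  linarith [mul_le_mul_of_nonneg_left hmain (neg_pos.2 hneg).le]
end
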